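/- arXiv:math/0702763 — 3 statements merged into one kernel-verified Lean document; each statement's English description precedes it below -/
import Mathlib

section
/- Let E : ℝ×ℝ×ℝ³ → ℝ³ be C¹ with bounded derivatives and 2π-periodic in its second argument, and let (Y⁰,U⁰) solve dY⁰/dt = U⁰_∥, dU⁰/dt = (1/2π)∫₀^{2π} R(−θ)E(t,θ,Y⁰) dθ, with Y⁰(s) = x, U⁰(s) = v. Then for every T > 0, lim_{ε→0} sup_{t∈[s,s+T]} |X_ε(t) − Y⁰(t)| = 0 and lim_{ε→0} sup_{t∈[s,s+T]} |V_ε(t) − R((t−s)/ε)U⁰(t)| = 0. -/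
open Real Set Filter Matrix MeasureTheory intervalIntegral

/-- The rotation matrix of angle `-θ` around the first axis. -/
noncomputable def Rrot (θ : ℝ) : Matrix (Fin 3) (Fin 3) ℝ :=
  !![1, 0, 0; 0, Real.cos θ, Real.sin θ; 0, -Real.sin θ, Real.cos θ]

/-- The matrix `𝓡(θ)`. -/
noncomputable def scrR (θ : ℝ) : Matrix (Fin 3) (Fin 3) ℝ :=
  !![0, 0, 0; 0, Real.sin θ, 1 - Real.cos θ; 0, Real.cos θ - 1, Real.sin θ]

/-- The orthogonal projection onto the first axis. -/
noncomputable def Pmat : Matrix (Fin 3) (Fin 3) ℝ := !![1, 0, 0; 0, 0, 0; 0, 0, 0]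

/-- The first vector of the canonical basis of `ℝ³`. -/
noncomputable def ee1 : Fin 3 → ℝ := ![1, 0, 0]

/-- The third vector of the canonical basis of `ℝ³`. -/
noncomputable def ee3 : Fin 3 → ℝ := ![0, 0, 1]

/-- The component of `v` parallel to the first axis: `v_∥ = (v·e₁)e₁`. -/
noncomputable def vpar (v : Fin 3 → ℝ) : Fin 3 → ℝ := ![v 0, 0, 0]

/-- The cross product on `ℝ³`. -/
def cross3 (u v : Fin 3 → ℝ) : Fin 3 → ℝ :=
  ![u 1 * v 2 - u 2 * v 1, u 2 * v 0 - u 0 * v 2, u 0 * v 1 - u 1 * v 0]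

/-- The Euclidean norm on `ℝ³`. -/
noncomputable def euclN (v : Fin 3 → ℝ) : ℝ := Real.sqrt (v 0 ^ 2 + v 1 ^ 2 + v 2 ^ 2)

/-- Averaging estimate: the primitive of the oscillating part of a two-scale function which is
Lipschitz in the slow variable and periodic in the fast one is of the order of the period. -/
lemma norm_le_of_hasDerivAt_sub_average {A : Type*} [NormedAddCommGroup A] [NormedSpace ℝ A]
    [CompleteSpace A] {f : ℝ → ℝ → A} {G : ℝ → A} {s T L M ε : ℝ} (hε : 0 < ε) (hL : 0 ≤ L)
    (hf : ∀ t, Continuous (f t)) (hper : ∀ t, Function.Periodic (f t) (2 * π))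
    (hM : ∀ t θ, ‖f t θ‖ ≤ M)
    (hLip : ∀ t ∈ Icc s (s + T), ∀ τ ∈ Icc s (s + T), ∀ θ, ‖f t θ - f τ θ‖ ≤ L * |t - τ|)
    (hG : ∀ t, HasDerivAt G
      (f t ((t - s) / ε) - (2 * π)⁻¹ • ∫ θ in (0 : ℝ)..(2 * π), f t θ) t)
    (hGs : G s = 0) :
    ∀ t ∈ Icc s (s + T), ‖G t‖ ≤ (2 * π * (2 * L * T + 2 * M)) * ε := by
  set m : ℝ → A := fun t => (2 * π)⁻¹ • ∫ θ in (0 : ℝ)..(2 * π), f t θ with hm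
  set h : ℝ := 2 * π * ε with hh
  have hpi : (0 : ℝ) < 2 * π := by positivity
  have hh0 : 0 < h := by positivity
  have hmM : ∀ t, ‖m t‖ ≤ M := by
    intro t
    have := intervalIntegral.norm_integral_le_of_norm_le_const (a := (0 : ℝ)) (b := 2 * π)
      (f := f t) (C := M) (fun θ _ => hM t θ)
    rw [sub_zero, abs_of_pos hpi] at this
    rw [hm, norm_smul, norm_inv, Real.norm_of_nonneg hpi.le, inv_mul_le_iff₀ hpi]
    linarith
  have hmL : ∀ t ∈ Icc s (s + T), ∀ τ ∈ Icc s (s + T), ‖m t - m τ‖ ≤ L * |t - τ| := by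
    intro t ht τ hτ
    have := intervalIntegral.norm_integral_le_of_norm_le_const (a := (0 : ℝ)) (b := 2 * π)
      (f := fun θ => f t θ - f τ θ) (C := L * |t - τ|) (fun θ _ => hLip t ht τ hτ θ)
    rw [sub_zero, abs_of_pos hpi, intervalIntegral.integral_sub
      ((hf t).intervalIntegrable _ _) ((hf τ).intervalIntegrable _ _)] at this
    simp only [hm]
    rw [← smul_sub, norm_smul, norm_inv, Real.norm_of_nonneg hpi.le, inv_mul_le_iff₀ hpi]
    linarith
  have step : ∀ t, s ≤ t → t + h ≤ s + T → ‖G (t + h) - G t‖ ≤ 2 * L * h * h := by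
    intro t hst hth
    have hc : Continuous fun τ => f t ((τ - s) / ε) := (hf t).comp (by fun_prop)
    set φ : ℝ → A := fun σ => (∫ τ in t..σ, f t ((τ - s) / ε)) - (σ - t) • m t with hφ
    have hφt : φ t = 0 := by simp [hφ]
    have hφh : φ (t + h) = 0 := by
      have h1 : (∫ τ in t..(t + h), f t ((τ - s) / ε))
          = ε • ∫ θ in (0 : ℝ)..(2 * π), f t θ := by
        have e1 : (∫ τ in t..(t + h), f t ((τ - s) / ε))
            = ∫ τ in (t - s)..(t + h - s), f t (τ / ε) :=
          intervalIntegral.integral_comp_sub_right (fun u => f t (u / ε)) s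
        rw [e1, intervalIntegral.integral_comp_div _ hε.ne']
        have e2 : (t + h - s) / ε = (t - s) / ε + 2 * π := by
          rw [hh]; field_simp; ring
        rw [e2, (hper t).intervalIntegral_add_eq ((t - s) / ε) 0, zero_add]
      simp only [hφ, h1, hm, smul_smul]
      rw [show (t + h - t) * (2 * π)⁻¹ = ε by rw [hh]; field_simp; ring, sub_self]
    have hφd : ∀ σ, HasDerivAt φ (f t ((σ - s) / ε) - m t) σ := by
      intro σ
      have d1 := intervalIntegral.integral_hasDerivAt_right (hc.intervalIntegrable t σ)
        hc.stronglyMeasurable.stronglyMeasurableAtFilter hc.continuousAt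
      have d2 := ((hasDerivAt_id σ).sub_const t).smul_const (m t)
      rw [one_smul] at d2
      exact d1.sub d2
    have key := norm_image_sub_le_of_norm_deriv_le_segment' (f := fun σ => G σ - φ σ)
      (f' := fun σ => (f σ ((σ - s) / ε) - m σ) - (f t ((σ - s) / ε) - m t))
      (a := t) (b := t + h) (C := 2 * L * h)
      (fun σ _ => ((hG σ).sub (hφd σ)).hasDerivWithinAt)
      (by
        intro σ hσ
        have hσI : σ ∈ Icc s (s + T) := ⟨hst.trans hσ.1, hσ.2.le.trans hth⟩
        have htI : t ∈ Icc s (s + T) := ⟨hst, by linarith⟩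
        have a1 := hLip σ hσI t htI ((σ - s) / ε)
        have a2 := hmL σ hσI t htI
        have a3 : |σ - t| ≤ h := by
          rw [abs_of_nonneg (by linarith [hσ.1])]; linarith [hσ.2]
        have a4 : L * |σ - t| ≤ L * h := by gcongr
        rw [sub_sub_sub_comm]
        refine (norm_sub_le _ _).trans ?_
        linarith)
      (t + h) (right_mem_Icc.2 (by linarith))
    simpa [hφt, hφh] using key
  have multi : ∀ n : ℕ, s + n * h ≤ s + T → ‖G (s + n * h)‖ ≤ n * (2 * L * h * h) := by
    intro n
    induction n with
    | zero => intro _; simp [hGs]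
    | succ k ih =>
      intro hk
      push_cast at hk ⊢
      have e : s + (k + 1) * h = (s + k * h) + h := by ring
      rw [e] at hk ⊢
      have h1 := ih (by linarith)
      have h2 := step (s + k * h) (by have : 0 ≤ k * h := by positivity
                                      linarith) hk
      calc ‖G (s + k * h + h)‖ = ‖(G (s + k * h + h) - G (s + k * h)) + G (s + k * h)‖ := by
            rw [sub_add_cancel]
        _ ≤ 2 * L * h * h + k * (2 * L * h * h) := (norm_add_le _ _).trans (add_le_add h2 h1)
        _ = (k + 1) * (2 * L * h * h) := by ring
  intro t ht
  set n := ⌊(t - s) / h⌋₊ with hn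
  have hts : 0 ≤ (t - s) / h := div_nonneg (by linarith [ht.1]) hh0.le
  have n1 : n * h ≤ t - s := by
    have := Nat.floor_le hts
    rwa [← hn, le_div_iff₀ hh0] at this
  have n2 : t - s < (n + 1) * h := by
    have := Nat.lt_floor_add_one ((t - s) / h)
    rwa [← hn, div_lt_iff₀ hh0] at this
  have g1 := multi n (by linarith [ht.2])
  have g2 := norm_image_sub_le_of_norm_deriv_le_segment' (f := G)
    (f' := fun σ => f σ ((σ - s) / ε) - m σ) (a := s + n * h) (b := t) (C := 2 * M)
    (fun σ _ => (hG σ).hasDerivWithinAt)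
    (fun σ _ => (norm_sub_le _ _).trans (by linarith [hM σ ((σ - s) / ε), hmM σ]))
    t (right_mem_Icc.2 (by linarith))
  have hM0 : 0 ≤ M := (norm_nonneg _).trans (hM 0 0)
  have g3 : 2 * M * (t - (s + n * h)) ≤ 2 * M * h := by
    gcongr; linarith
  have g4 : n * (2 * L * h * h) ≤ T * (2 * L * h) := by
    have : n * (2 * L * h * h) = (n * h) * (2 * L * h) := by ring
    rw [this]
    gcongr
    linarith [ht.2]
  calc ‖G t‖ = ‖(G t - G (s + n * h)) + G (s + n * h)‖ := by rw [sub_add_cancel]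
    _ ≤ 2 * M * h + T * (2 * L * h) := (norm_add_le _ _).trans (by linarith)
    _ = _ := by rw [hh]; ring

lemma norm_rrot_mulVec_le (θ : ℝ) (w : Fin 3 → ℝ) : ‖(Rrot θ).mulVec w‖ ≤ 2 * ‖w‖ := by
  have hw := fun i => norm_le_pi_norm w i
  simp only [Real.norm_eq_abs] at hw
  have hc := Real.abs_cos_le_one θ
  have hs := Real.abs_sin_le_one θ
  have hmul : ∀ a : ℝ, |a| ≤ 1 → ∀ i, |a * w i| ≤ ‖w‖ := fun a ha i => by
    rw [abs_mul]
    exact (mul_le_of_le_one_left (abs_nonneg _) ha).trans (hw i)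
  refine (pi_norm_le_iff_of_nonneg (by positivity)).2 fun i => ?_
  fin_cases i
  · simp only [Rrot, mulVec, dotProduct, Fin.sum_univ_three]
    simp
    linarith [hw 0, norm_nonneg w]
  · simp only [Rrot, mulVec, dotProduct, Fin.sum_univ_three]
    simp
    exact (abs_add_le _ _).trans (by linarith [hmul _ hc 1, hmul _ hs 2])
  · simp only [Rrot, mulVec, dotProduct, Fin.sum_univ_three]
    simp
    refine (abs_add_le _ _).trans ?_
    rw [abs_neg]
    linarith [hmul _ hs 1, hmul _ hc 2]

lemma rrot_mulVec_rrot_neg (θ : ℝ) (w : Fin 3 → ℝ) :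
    (Rrot θ).mulVec ((Rrot (-θ)).mulVec w) = w := by
  have h := Real.sin_sq_add_cos_sq θ
  ext i
  fin_cases i <;> simp [Rrot, mulVec, dotProduct, Fin.sum_univ_three]
  · linear_combination (w 1) * h
  · linear_combination (w 2) * h

/-- The rotation by a right angle in the plane orthogonal to the first axis. -/
def quarterTurn (w : Fin 3 → ℝ) : Fin 3 → ℝ := ![0, -w 2, w 1]

lemma norm_quarterTurn_le (w : Fin 3 → ℝ) : ‖quarterTurn w‖ ≤ ‖w‖ := by
  refine (pi_norm_le_iff_of_nonneg (by positivity)).2 fun i => ?_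
  have h1 := norm_le_pi_norm w 1
  have h2 := norm_le_pi_norm w 2
  simp only [Real.norm_eq_abs] at h1 h2
  fin_cases i <;> simp [quarterTurn, h1, h2]

lemma norm_vpar_le (w : Fin 3 → ℝ) : ‖vpar w‖ ≤ ‖w‖ := by
  refine (pi_norm_le_iff_of_nonneg (by positivity)).2 fun i => ?_
  have h := norm_le_pi_norm w 0
  simp only [Real.norm_eq_abs] at h
  fin_cases i <;> simp [vpar, h]

lemma euclN_le (w : Fin 3 → ℝ) : euclN w ≤ 2 * ‖w‖ := by
  have hw : ∀ i, w i ^ 2 ≤ ‖w‖ ^ 2 := fun i => by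
    rw [← sq_abs]
    exact pow_le_pow_left₀ (abs_nonneg _) (norm_le_pi_norm w i) 2
  refine Real.sqrt_le_iff.2 ⟨by positivity, ?_⟩
  nlinarith [hw 0, hw 1, hw 2, sq_nonneg ‖w‖]

lemma hasDerivAt_rrot_neg_mulVec {V : ℝ → Fin 3 → ℝ} {e : Fin 3 → ℝ} {s ε t : ℝ}
    (hV : HasDerivAt V (e + ε⁻¹ • cross3 (V t) ee1) t) :
    HasDerivAt (fun τ => (Rrot (-((τ - s) / ε))).mulVec (V τ))
      ((Rrot (-((t - s) / ε))).mulVec e) t := by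
  have hV' := hasDerivAt_pi.1 hV
  have hθ : HasDerivAt (fun τ : ℝ => (τ - s) / ε) (ε⁻¹) t := by
    simpa using ((hasDerivAt_id t).sub_const s).div_const ε
  have hc := hθ.cos
  have hs := hθ.sin
  refine hasDerivAt_pi.2 fun i => ?_
  have h0 := hV' 0
  have h1 := hV' 1
  have h2 := hV' 2
  fin_cases i <;>
    simp [Rrot, mulVec, dotProduct, Fin.sum_univ_three, cross3, ee1] at h0 h1 h2 ⊢
  · exact h0
  · convert (hc.mul h1).add ((hs.mul h2).neg) using 1
    · ext τ; simp
    · ring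
  · refine ((hs.mul h1).add (hc.mul h2)).congr_deriv ?_
    ring

lemma tendsto_iSup_of_le_mul {s T C : ℝ} {w : ℝ → ℝ → Fin 3 → ℝ} (hT : 0 < T)
    (hC : ∀ ε, 0 < ε → ε ≤ 1 → ∀ t ∈ Icc s (s + T), ‖w ε t‖ ≤ C * ε) :
    Tendsto (fun ε : ℝ => ⨆ t : Icc s (s + T), euclN (w ε t.1))
      (nhdsWithin 0 (Ioi 0)) (nhds 0) := by
  have hlim : Tendsto (fun ε : ℝ => 2 * (C * ε)) (nhdsWithin 0 (Ioi 0)) (nhds 0) := by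
    have : Continuous fun ε : ℝ => 2 * (C * ε) := by fun_prop
    simpa using (this.tendsto 0).mono_left nhdsWithin_le_nhds
  have hmem : Ioc (0 : ℝ) 1 ∈ nhdsWithin (0 : ℝ) (Ioi 0) := Ioc_mem_nhdsGT one_pos
  have : Nonempty (Icc s (s + T)) := ⟨⟨s, le_rfl, by linarith⟩⟩
  refine tendsto_of_tendsto_of_tendsto_of_le_of_le' tendsto_const_nhds hlim ?_ ?_
  · exact Eventually.of_forall fun ε => Real.iSup_nonneg fun t => Real.sqrt_nonneg _
  · filter_upwards [hmem] with ε hε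
    exact ciSup_le fun t => (euclN_le _).trans
      (mul_le_mul_of_nonneg_left (hC ε hε.1 hε.2 t t.2) zero_le_two)

set_option maxHeartbeats 1000000 in
/-- Order-0 two-scale asymptotics for the Isotope Resonant Separation regime with a
constant strong magnetic field. -/
theorem stmt_6
    (E : ℝ → ℝ → (Fin 3 → ℝ) → (Fin 3 → ℝ))
    (hEreg : ContDiff ℝ 1 (fun p : ℝ × ℝ × (Fin 3 → ℝ) => E p.1 p.2.1 p.2.2))
    (hEbdd : ∀ k : ℕ, k ≤ 1 → ∃ C : ℝ, ∀ p : ℝ × ℝ × (Fin 3 → ℝ),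
      ‖iteratedFDeriv ℝ k (fun q : ℝ × ℝ × (Fin 3 → ℝ) => E q.1 q.2.1 q.2.2) p‖ ≤ C)
    (hEper : ∀ t θ z, E t (θ + 2 * π) z = E t θ z)
    (x v : Fin 3 → ℝ) (s : ℝ)
    (X V : ℝ → ℝ → (Fin 3 → ℝ))
    (hXinit : ∀ ε : ℝ, 0 < ε → X ε s = x)
    (hVinit : ∀ ε : ℝ, 0 < ε → V ε s = v)
    (hXode : ∀ ε : ℝ, 0 < ε → ∀ t : ℝ, HasDerivAt (X ε) (V ε t) t)
    (hVode : ∀ ε : ℝ, 0 < ε → ∀ t : ℝ, HasDerivAt (V ε)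
      (E t ((t - s) / ε) (X ε t) + ε⁻¹ • cross3 (V ε t) ee1) t)
    (Y0 U0 : ℝ → (Fin 3 → ℝ))
    (hY0init : Y0 s = x) (hU0init : U0 s = v)
    (hY0ode : ∀ t : ℝ, HasDerivAt Y0 (vpar (U0 t)) t)
    (hU0ode : ∀ t : ℝ, HasDerivAt U0
      ((2 * π)⁻¹ • ∫ θ in (0:ℝ)..(2 * π), (Rrot (-θ)).mulVec (E t θ (Y0 t))) t) :
    ∀ T : ℝ, 0 < T →
      Tendsto (fun ε : ℝ => ⨆ t : Icc s (s + T), euclN (X ε t.1 - Y0 t.1))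
        (nhdsWithin 0 (Ioi 0)) (nhds 0) ∧
      Tendsto (fun ε : ℝ => ⨆ t : Icc s (s + T),
          euclN (V ε t.1 - (Rrot ((t.1 - s) / ε)).mulVec (U0 t.1)))
        (nhdsWithin 0 (Ioi 0)) (nhds 0) := by
  intro T hT
  obtain ⟨M, hM⟩ := hEbdd 0 (by norm_num)
  obtain ⟨L, hL⟩ := hEbdd 1 le_rfl
  simp only [norm_iteratedFDeriv_zero] at hM
  simp only [norm_iteratedFDeriv_one] at hL
  have hM' : ∀ t θ z, ‖E t θ z‖ ≤ M := fun t θ z => hM (t, θ, z)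
  have hM0 : 0 ≤ M := (norm_nonneg _).trans (hM 0)
  have hL0 : 0 ≤ L := (norm_nonneg _).trans (hL 0)
  have hElip : ∀ t τ θ z w, ‖E t θ z - E τ θ w‖ ≤ L * max |t - τ| ‖z - w‖ := by
    intro t τ θ z w
    have := convex_univ.norm_image_sub_le_of_norm_fderiv_le (𝕜 := ℝ)
      (fun p _ => (hEreg.differentiable one_ne_zero).differentiableAt) (fun p _ => hL p)
      (mem_univ (τ, θ, w)) (mem_univ (t, θ, z))
    simpa [Prod.norm_def] using this
  have hEcont : Continuous fun p : ℝ × ℝ × (Fin 3 → ℝ) => E p.1 p.2.1 p.2.2 := hEreg.continuous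
  have hRcont : Continuous fun θ : ℝ => Rrot (-θ) := by
    refine continuous_matrix fun i j => ?_
    fin_cases i <;> fin_cases j <;> simp [Rrot] <;> fun_prop
  set F : ℝ → ℝ → (Fin 3 → ℝ) → (Fin 3 → ℝ) := fun t θ z => (Rrot (-θ)).mulVec (E t θ z) with hF
  have hFM : ∀ t θ z, ‖F t θ z‖ ≤ 2 * M := fun t θ z =>
    (norm_rrot_mulVec_le _ _).trans (by linarith [hM' t θ z])
  have hFlip : ∀ t τ θ z w, ‖F t θ z - F τ θ w‖ ≤ 2 * (L * max |t - τ| ‖z - w‖) := by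
    intro t τ θ z w
    simp only [hF, ← mulVec_sub]
    exact (norm_rrot_mulVec_le _ _).trans (by linarith [hElip t τ θ z w])
  have hFcont : Continuous fun p : ℝ × ℝ × (Fin 3 → ℝ) => F p.1 p.2.1 p.2.2 :=
    (hRcont.comp (continuous_fst.comp continuous_snd)).matrix_mulVec hEcont
  have hFper : ∀ t z, Function.Periodic (fun θ => F t θ z) (2 * π) := by
    intro t z θ
    simp only [hF, hEper]
    congr 1
    simp [Rrot, Real.cos_add_two_pi, Real.sin_add_two_pi, -neg_add_rev, Real.cos_neg, Real.sin_neg]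
  have hY0cont : Continuous Y0 := continuous_iff_continuousAt.2 fun t => (hY0ode t).continuousAt
  have hU0cont : Continuous U0 := continuous_iff_continuousAt.2 fun t => (hU0ode t).continuousAt
  obtain ⟨B0, hB0⟩ := (isCompact_Icc (a := s) (b := s + T)).exists_bound_of_continuousOn
    hU0cont.continuousOn
  have hB0nn : 0 ≤ B0 := (norm_nonneg _).trans (hB0 s ⟨le_rfl, by linarith⟩)
  have hY0lip : ∀ t ∈ Icc s (s + T), ∀ τ ∈ Icc s (s + T), ‖Y0 t - Y0 τ‖ ≤ B0 * |t - τ| := by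
    intro t ht τ hτ
    exact (convex_Icc s (s + T)).norm_image_sub_le_of_norm_hasDerivWithin_le
      (fun σ _ => (hY0ode σ).hasDerivWithinAt)
      (fun σ hσ => (norm_vpar_le _).trans (hB0 σ hσ)) hτ ht
  set L₁ : ℝ := 2 * (L * (1 + B0)) with hL₁
  have hL₁0 : 0 ≤ L₁ := by positivity
  have hFYlip : ∀ t ∈ Icc s (s + T), ∀ τ ∈ Icc s (s + T), ∀ θ,
      ‖F t θ (Y0 t) - F τ θ (Y0 τ)‖ ≤ L₁ * |t - τ| := by
    intro t ht τ hτ θ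
    have h1 : max |t - τ| ‖Y0 t - Y0 τ‖ ≤ (1 + B0) * |t - τ| := by
      have := hY0lip t ht τ hτ
      have a := abs_nonneg (t - τ)
      refine max_le ?_ ?_ <;> nlinarith
    refine (hFlip t τ θ _ _).trans ?_
    rw [hL₁, mul_assoc, mul_assoc]
    gcongr
  set C₁ : ℝ := 2 * π * (2 * L₁ * T + 2 * (2 * M)) with hC₁
  have hC₁0 : 0 ≤ C₁ := by positivity
  set B : ℝ := 2 * ‖v‖ + 2 * M * T with hB
  have hBnn : 0 ≤ B := by positivity
  set D : ℝ := C₁ + 3 * M + 6 * L * B with hD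
  have hDnn : 0 ≤ D := by positivity
  set C₂ : ℝ := D / (1 + 2 * L) * (Real.exp ((1 + 2 * L) * T) - 1) with hC₂
  have main : ∀ ε : ℝ, 0 < ε → ∀ t ∈ Icc s (s + T),
      ‖X ε t - Y0 t‖ ≤ (C₂ + 3 * B) * ε ∧
      ‖(Rrot (-((t - s) / ε))).mulVec (V ε t) - U0 t‖ ≤ (C₂ + C₁) * ε := by
    intro ε hε
    set U : ℝ → Fin 3 → ℝ := fun t => (Rrot (-((t - s) / ε))).mulVec (V ε t) with hU
    have hUd : ∀ t, HasDerivAt U (F t ((t - s) / ε) (X ε t)) t := fun t =>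
      hasDerivAt_rrot_neg_mulVec (hVode ε hε t)
    have hVU : ∀ t, V ε t = (Rrot ((t - s) / ε)).mulVec (U t) := fun t =>
      (rrot_mulVec_rrot_neg _ _).symm
    have hUs : U s = v := by
      ext i
      fin_cases i <;>
        simp [hU, Rrot, dotProduct, Fin.sum_univ_three, hVinit ε hε]
    have hUB : ∀ t ∈ Icc s (s + T), ‖U t‖ ≤ B := by
      intro t ht
      have h1 := norm_image_sub_le_of_norm_deriv_le_segment' (f := U) (C := 2 * M)
        (fun σ _ => (hUd σ).hasDerivWithinAt) (fun σ _ => hFM _ _ _) t ht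
      have h2 : 2 * M * (t - s) ≤ 2 * M * T := by gcongr; linarith [ht.2]
      have h3 : ‖U t‖ ≤ ‖U t - U s‖ + ‖v‖ := by
        simpa [hUs] using norm_add_le (U t - U s) (U s)
      linarith [norm_nonneg v]
    have hVUB : ∀ t ∈ Icc s (s + T), ‖V ε t - U t‖ ≤ 3 * B := by
      intro t ht
      have h1 := norm_rrot_mulVec_le ((t - s) / ε) (U t)
      rw [← hVU] at h1
      exact (norm_sub_le _ _).trans (by linarith [hUB t ht])
    have hFYc : Continuous fun τ => F τ ((τ - s) / ε) (Y0 τ) :=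
      hFcont.comp (f := fun τ => (τ, (τ - s) / ε, Y0 τ)) (by fun_prop)
    set g : ℝ → Fin 3 → ℝ := fun t =>
      (∫ τ in s..t, F τ ((τ - s) / ε) (Y0 τ)) - (U0 t - U0 s) with hg
    have hgd : ∀ t, HasDerivAt g (F t ((t - s) / ε) (Y0 t)
        - (2 * π)⁻¹ • ∫ θ in (0 : ℝ)..(2 * π), F t θ (Y0 t)) t := fun t =>
      (intervalIntegral.integral_hasDerivAt_right (hFYc.intervalIntegrable s t)
        hFYc.stronglyMeasurable.stronglyMeasurableAtFilter hFYc.continuousAt).sub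
        ((hU0ode t).sub_const _)
    have hgB : ∀ t ∈ Icc s (s + T), ‖g t‖ ≤ C₁ * ε :=
      norm_le_of_hasDerivAt_sub_average (f := fun t θ => F t θ (Y0 t)) hε hL₁0
        (fun t => hFcont.comp (f := fun θ : ℝ => (t, θ, Y0 t)) (by fun_prop))
        (fun t => hFper t _) (fun t θ => hFM _ _ _) hFYlip hgd (by simp [hg])
    set P₁ : ℝ → Fin 3 → ℝ := fun t => X ε t - ε • quarterTurn (V ε t - U t) - Y0 t with hP₁
    set P₂ : ℝ → Fin 3 → ℝ := fun t => U t - U0 t - g t with hP₂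
    have hP₁d : ∀ t, HasDerivAt P₁ (vpar (U t - U0 t) - ε • quarterTurn
        (E t ((t - s) / ε) (X ε t) - F t ((t - s) / ε) (X ε t))) t := by
      intro t
      have q : HasDerivAt (fun t => quarterTurn (V ε t - U t))
          (quarterTurn ((E t ((t - s) / ε) (X ε t) + ε⁻¹ • cross3 (V ε t) ee1)
            - F t ((t - s) / ε) (X ε t))) t := by
        have h := hasDerivAt_pi.1 ((hVode ε hε t).sub (hUd t))
        refine hasDerivAt_pi.2 fun i => ?_
        fin_cases i
        · exact hasDerivAt_const _ _
        · exact (h 2).neg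
        · exact h 1
      have hUV0 : U t 0 = V ε t 0 := by
        simp [hU, Rrot, dotProduct, Fin.sum_univ_three]
      refine (((hXode ε hε t).sub (q.const_smul ε)).sub (hY0ode t)).congr_deriv ?_
      ext i
      fin_cases i <;> simp [vpar, quarterTurn, cross3, ee1, hUV0, vecHead, vecTail] <;> field_simp <;> ring
    have hP₂d : ∀ t, HasDerivAt P₂ (F t ((t - s) / ε) (X ε t) - F t ((t - s) / ε) (Y0 t)) t := by
      intro t
      refine (((hUd t).sub (hU0ode t)).sub (hgd t)).congr_deriv ?_
      abel
    have hXP : ∀ t ∈ Icc s (s + T), ‖X ε t - Y0 t‖ ≤ ‖P₁ t‖ + 3 * B * ε := by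
      intro t ht
      have e : X ε t - Y0 t = P₁ t + ε • quarterTurn (V ε t - U t) := by
        simp only [hP₁]; abel
      rw [e]
      refine (norm_add_le _ _).trans ?_
      rw [norm_smul, Real.norm_of_nonneg hε.le, mul_comm]
      gcongr
      exact (norm_quarterTurn_le _).trans (hVUB t ht)
    have hUP : ∀ t ∈ Icc s (s + T), ‖U t - U0 t‖ ≤ ‖P₂ t‖ + C₁ * ε := by
      intro t ht
      have e : U t - U0 t = P₂ t + g t := by simp only [hP₂]; abel
      rw [e]
      exact (norm_add_le _ _).trans (by linarith [hgB t ht])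
    have hP0 : ‖(P₁ s, P₂ s)‖ ≤ 0 := by
      have h1 : P₁ s = 0 := by
        ext i
        fin_cases i <;> simp [hP₁, hXinit ε hε, hVinit ε hε, hUs, hY0init, quarterTurn]
      have h2 : P₂ s = 0 := by simp [hP₂, hg, hUs, hU0init]
      simp [h1, h2]
    have hgron := norm_le_gronwallBound_of_norm_deriv_right_le
      (f := fun t => (P₁ t, P₂ t)) (δ := 0) (K := 1 + 2 * L) (ε := D * ε) (a := s) (b := s + T)
      (fun t _ => ((hP₁d t).prodMk (hP₂d t)).continuousAt.continuousWithinAt)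
      (fun t _ => ((hP₁d t).prodMk (hP₂d t)).hasDerivWithinAt) hP0
      (by
        intro t ht
        have htI : t ∈ Icc s (s + T) := Ico_subset_Icc_self ht
        have n1 : ‖P₁ t‖ ≤ ‖(P₁ t, P₂ t)‖ := norm_fst_le (P₁ t, P₂ t)
        have n2 : ‖P₂ t‖ ≤ ‖(P₁ t, P₂ t)‖ := norm_snd_le (P₁ t, P₂ t)
        have hp := norm_nonneg (P₁ t, P₂ t)
        have hLp : 0 ≤ L * ‖(P₁ t, P₂ t)‖ := by positivity
        have hMε : 0 ≤ M * ε := by positivity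
        have hCε : 0 ≤ C₁ * ε := by positivity
        have hLBε : 0 ≤ L * B * ε := by positivity
        rw [Prod.norm_mk]
        refine max_le ?_ ?_
        · have q : ‖ε • quarterTurn
              (E t ((t - s) / ε) (X ε t) - F t ((t - s) / ε) (X ε t))‖ ≤ ε * (3 * M) := by
            rw [norm_smul, Real.norm_of_nonneg hε.le]
            gcongr
            exact (norm_quarterTurn_le _).trans ((norm_sub_le _ _).trans
              (by linarith [hM' t ((t - s) / ε) (X ε t), hFM t ((t - s) / ε) (X ε t)]))
          refine (norm_sub_le _ _).trans ?_
          have := (norm_vpar_le (U t - U0 t)).trans (hUP t htI)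
          rw [hD]
          nlinarith
        · have h1 := hFlip t t ((t - s) / ε) (X ε t) (Y0 t)
          rw [sub_self, abs_zero, max_eq_right (norm_nonneg _)] at h1
          have h2 : L * ‖X ε t - Y0 t‖ ≤ L * (‖(P₁ t, P₂ t)‖ + 3 * B * ε) := by
            gcongr
            linarith [hXP t htI]
          rw [hD]
          nlinarith)
    have hPB : ∀ t ∈ Icc s (s + T), ‖(P₁ t, P₂ t)‖ ≤ C₂ * ε := by
      intro t ht
      refine (hgron t ht).trans ?_
      rw [gronwallBound_of_K_ne_0 (by positivity)]
      simp only [zero_mul, zero_add]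
      rw [hC₂, mul_div_right_comm, mul_right_comm]
      have : t - s ≤ T := by linarith [ht.2]
      gcongr
    intro t ht
    have n1 : ‖P₁ t‖ ≤ ‖(P₁ t, P₂ t)‖ := norm_fst_le (P₁ t, P₂ t)
    have n2 : ‖P₂ t‖ ≤ ‖(P₁ t, P₂ t)‖ := norm_snd_le (P₁ t, P₂ t)
    exact ⟨by linarith [hXP t ht, hPB t ht], by linarith [hUP t ht, hPB t ht]⟩
  refine ⟨tendsto_iSup_of_le_mul (w := fun ε t => X ε t - Y0 t) hT
      fun ε hε _ t ht => (main ε hε t ht).1,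
    tendsto_iSup_of_le_mul (C := 2 * (C₂ + C₁))
      (w := fun ε t => V ε t - (Rrot ((t - s) / ε)).mulVec (U0 t)) hT
      fun ε hε _ t ht => ?_⟩
  have h := (main ε hε t ht).2
  have e : V ε t - (Rrot ((t - s) / ε)).mulVec (U0 t) = (Rrot ((t - s) / ε)).mulVec
      ((Rrot (-((t - s) / ε))).mulVec (V ε t) - U0 t) := by
    rw [mulVec_sub, rrot_mulVec_rrot_neg]
  simp only [e]
  exact (norm_rrot_mulVec_le _ _).trans (by linarith)
end

section
/- Let E : ℝ×ℝ³ → ℝ³ be C² with bounded derivatives, and let (Y⁰,U⁰) solve dY⁰/dt = U⁰_∥, dU⁰/dt = E_∥(t,Y⁰), with Y⁰(s) = x, U⁰(s) = v. Then for every T > 0, lim_{ε→0} sup_{t∈[s,s+T]} |X_ε(t) − Y⁰(t)| = 0 and lim_{ε→0} sup_{t∈[s,s+T]} |V_ε(t) − R((t−s)/ε)U⁰(t)| = 0. -/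
open Real Set Filter Matrix MeasureTheory intervalIntegral

/-- Grönwall's inequality in differential form on a compact interval. -/
theorem le_of_deriv_le_mul_add {f f' : ℝ → ℝ} {s T K c δ : ℝ} (hK : 0 ≤ K) (hc : 0 ≤ c)
    (hδ : 0 ≤ δ) (hf : ∀ t, HasDerivAt f (f' t) t)
    (hf' : ∀ t ∈ Icc s (s + T), f' t ≤ K * f t + c) (hs : f s ≤ δ) :
    ∀ t ∈ Icc s (s + T), f t ≤ (δ + c * T) * Real.exp (K * T) := by
  intro t ht
  have hg : ∀ r, HasDerivAt (fun r => f r * Real.exp (-(K * (r - s))) - c * (r - s))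
      (f' r * Real.exp (-(K * (r - s))) + f r * (Real.exp (-(K * (r - s))) * (-(K * 1)))
        - c * 1) r := by
    intro r
    have h1 : HasDerivAt (fun r : ℝ => r - s) 1 r := (hasDerivAt_id r).sub_const s
    exact ((hf r).mul ((h1.const_mul K).neg.exp)).sub (h1.const_mul c)
  have hanti : AntitoneOn (fun r => f r * Real.exp (-(K * (r - s))) - c * (r - s))
      (Icc s (s + T)) := by
    refine antitoneOn_of_deriv_nonpos (convex_Icc _ _)
      (fun r _ => (hg r).continuousAt.continuousWithinAt)
      (fun r _ => (hg r).differentiableAt.differentiableWithinAt) ?_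
    intro r hr
    have hr' : r ∈ Icc s (s + T) := interior_subset hr
    rw [(hg r).deriv]
    have hpos := Real.exp_pos (-(K * (r - s)))
    have hle : Real.exp (-(K * (r - s))) ≤ 1 :=
      Real.exp_le_one_iff.mpr (neg_nonpos.mpr (mul_nonneg hK (sub_nonneg.mpr hr'.1)))
    nlinarith [mul_le_mul_of_nonneg_right (hf' r hr') hpos.le, mul_le_mul_of_nonneg_left hle hc]
  have hst : s ≤ s + T := ht.1.trans ht.2
  have h := hanti (left_mem_Icc.mpr hst) ht ht.1
  simp only [sub_self, mul_zero, neg_zero, Real.exp_zero, mul_one, sub_zero] at h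
  have h2 : f t * Real.exp (-(K * (t - s))) ≤ δ + c * T := by
    nlinarith [mul_le_mul_of_nonneg_left (show t - s ≤ T by linarith [ht.2]) hc]
  have hT : 0 ≤ T := by linarith
  calc f t = f t * Real.exp (-(K * (t - s))) * Real.exp (K * (t - s)) := by
        rw [mul_assoc, ← Real.exp_add]; simp
    _ ≤ (δ + c * T) * Real.exp (K * (t - s)) :=
        mul_le_mul_of_nonneg_right h2 (Real.exp_pos _).le
    _ ≤ (δ + c * T) * Real.exp (K * T) := by
        refine mul_le_mul_of_nonneg_left (Real.exp_le_exp.mpr ?_) (by positivity)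
        exact mul_le_mul_of_nonneg_left (by linarith [ht.2]) hK

/-- The energy of a forced planar rotation is controlled independently of its frequency. -/
theorem sq_add_sq_le_of_forced_rotation {a b p q : ℝ → ℝ} {s T ω m δ : ℝ} (hδ : 0 ≤ δ)
    (ha : ∀ t, HasDerivAt a (p t + ω * b t) t) (hb : ∀ t, HasDerivAt b (q t - ω * a t) t)
    (hp : ∀ t ∈ Icc s (s + T), |p t| ≤ m) (hq : ∀ t ∈ Icc s (s + T), |q t| ≤ m)
    (hs : a s ^ 2 + b s ^ 2 ≤ δ) :
    ∀ t ∈ Icc s (s + T), a t ^ 2 + b t ^ 2 ≤ (δ + 2 * m ^ 2 * T) * Real.exp T := by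
  have h := le_of_deriv_le_mul_add (f := fun t => a t ^ 2 + b t ^ 2) (s := s) (T := T)
    (K := 1) (c := 2 * m ^ 2) zero_le_one (by positivity) hδ
    (fun t => ((ha t).pow 2).add ((hb t).pow 2)) ?_ hs
  · simpa using h
  · intro t ht
    have h1 := sq_le_sq.mpr ((hp t ht).trans (le_abs_self m))
    have h2 := sq_le_sq.mpr ((hq t ht).trans (le_abs_self m))
    simp only [Nat.cast_ofNat, Nat.reduceSub, pow_one]
    nlinarith [sq_nonneg (a t - p t), sq_nonneg (b t - q t)]

theorem euclN_le_abs_add (w : Fin 3 → ℝ) : euclN w ≤ |w 0| + |w 1| + |w 2| := by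
  refine Real.sqrt_le_iff.mpr ⟨by positivity, ?_⟩
  nlinarith [abs_nonneg (w 0), abs_nonneg (w 1), abs_nonneg (w 2), sq_abs (w 0), sq_abs (w 1),
    sq_abs (w 2), mul_nonneg (abs_nonneg (w 0)) (abs_nonneg (w 1)),
    mul_nonneg (abs_nonneg (w 0)) (abs_nonneg (w 2)),
    mul_nonneg (abs_nonneg (w 1)) (abs_nonneg (w 2))]

theorem abs_le_sqrt_mul {a b K ε : ℝ} (hε : 0 < ε) (h : a ^ 2 + b ^ 2 ≤ K * ε ^ 2) :
    |a| ≤ √K * ε ∧ |b| ≤ √K * ε := by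
  have key : ∀ c : ℝ, c ^ 2 ≤ K * ε ^ 2 → |c| ≤ √K * ε := by
    intro c hc
    rw [← Real.sqrt_sq_eq_abs]
    refine (Real.sqrt_le_sqrt hc).trans_eq ?_
    rw [Real.sqrt_mul' _ (sq_nonneg ε), Real.sqrt_sq hε.le]
  exact ⟨key a (by nlinarith [sq_nonneg b]), key b (by nlinarith [sq_nonneg a])⟩

theorem tendsto_iSup_zero_of_le_mul {ι : Type*} [Nonempty ι] {g : ℝ → ι → ℝ} {C : ℝ}
    (h0 : ∀ ε i, 0 ≤ g ε i) (h : ∀ ε, 0 < ε → ε ≤ 1 → ∀ i, g ε i ≤ C * ε) :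
    Tendsto (fun ε : ℝ => ⨆ i, g ε i) (nhdsWithin 0 (Ioi 0)) (nhds 0) := by
  have hlim : Tendsto (fun ε : ℝ => C * ε) (nhdsWithin 0 (Ioi 0)) (nhds 0) := by
    have : Tendsto (fun ε : ℝ => C * ε) (nhds 0) (nhds (C * 0)) :=
      tendsto_id.const_mul C
    rw [mul_zero] at this
    exact this.mono_left nhdsWithin_le_nhds
  refine squeeze_zero' (Eventually.of_forall fun ε => Real.iSup_nonneg (h0 ε)) ?_ hlim
  filter_upwards [Ioc_mem_nhdsGT (zero_lt_one' ℝ)] with ε hε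
  exact ciSup_le (h ε hε.1 hε.2)

/-- Order-0 two-scale asymptotics for the Guiding Centre regime with a constant
strong magnetic field. -/
theorem stmt_8
    (E : ℝ → (Fin 3 → ℝ) → (Fin 3 → ℝ))
    (hEreg : ContDiff ℝ 2 (fun p : ℝ × (Fin 3 → ℝ) => E p.1 p.2))
    (hEbdd : ∀ k : ℕ, k ≤ 2 → ∃ C : ℝ, ∀ p : ℝ × (Fin 3 → ℝ),
      ‖iteratedFDeriv ℝ k (fun q : ℝ × (Fin 3 → ℝ) => E q.1 q.2) p‖ ≤ C)
    (x v : Fin 3 → ℝ) (s : ℝ)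
    (X V : ℝ → ℝ → (Fin 3 → ℝ))
    (hXinit : ∀ ε : ℝ, 0 < ε → X ε s = x)
    (hVinit : ∀ ε : ℝ, 0 < ε → V ε s = v)
    (hXode : ∀ ε : ℝ, 0 < ε → ∀ t : ℝ, HasDerivAt (X ε) (V ε t) t)
    (hVode : ∀ ε : ℝ, 0 < ε → ∀ t : ℝ, HasDerivAt (V ε)
      (E t (X ε t) + ε⁻¹ • cross3 (V ε t) ee1) t)
    (Y0 U0 : ℝ → (Fin 3 → ℝ))
    (hY0init : Y0 s = x) (hU0init : U0 s = v)
    (hY0ode : ∀ t : ℝ, HasDerivAt Y0 (vpar (U0 t)) t)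
    (hU0ode : ∀ t : ℝ, HasDerivAt U0 (vpar (E t (Y0 t))) t) :
    ∀ T : ℝ, 0 < T →
      Tendsto (fun ε : ℝ => ⨆ t : Icc s (s + T), euclN (X ε t.1 - Y0 t.1))
        (nhdsWithin 0 (Ioi 0)) (nhds 0) ∧
      Tendsto (fun ε : ℝ => ⨆ t : Icc s (s + T),
          euclN (V ε t.1 - (Rrot ((t.1 - s) / ε)).mulVec (U0 t.1)))
        (nhdsWithin 0 (Ioi 0)) (nhds 0) := by
  intro T hT
  set F : ℝ × (Fin 3 → ℝ) → (Fin 3 → ℝ) := fun p => E p.1 p.2 with hF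
  have hFd : Differentiable ℝ F := hEreg.differentiable (by norm_num)
  obtain ⟨M, hM⟩ : ∃ M, ∀ t y i, |E t y i| ≤ M := by
    obtain ⟨C, hC⟩ := hEbdd 0 (by norm_num)
    refine ⟨C, fun t y i => ?_⟩
    have := hC (t, y)
    rw [norm_iteratedFDeriv_zero] at this
    exact (norm_le_pi_norm (E t y) i).trans this
  obtain ⟨L, hL0, hL⟩ : ∃ L, 0 ≤ L ∧ ∀ p, ‖fderiv ℝ F p‖ ≤ L := by
    obtain ⟨C, hC⟩ := hEbdd 1 (by norm_num)
    have hC' : ∀ p, ‖fderiv ℝ F p‖ ≤ C := fun p => by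
      have := hC p
      rwa [← norm_iteratedFDeriv_fderiv, norm_iteratedFDeriv_zero] at this
    exact ⟨C, (norm_nonneg _).trans (hC' 0), hC'⟩
  have hM0 : 0 ≤ M := (abs_nonneg _).trans (hM 0 0 0)
  have hLip : ∀ t y z, |E t y 0 - E t z 0| ≤ L * ‖y - z‖ := by
    intro t y z
    have h := Convex.norm_image_sub_le_of_norm_fderiv_le (𝕜 := ℝ) (f := F) (s := univ)
      (fun p _ => hFd p) (fun p _ => hL p) convex_univ (mem_univ (t, z)) (mem_univ (t, y))
    have h2 : ‖((t, y) : ℝ × (Fin 3 → ℝ)) - (t, z)‖ = ‖y - z‖ := by simp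
    rw [h2] at h
    exact (norm_le_pi_norm (E t y - E t z) 0).trans h
  have hX : ∀ ε, 0 < ε → ∀ t i, HasDerivAt (fun r => X ε r i) (V ε t i) t :=
    fun ε hε t i => hasDerivAt_pi.mp (hXode ε hε t) i
  have hV : ∀ ε, 0 < ε → ∀ t, HasDerivAt (fun r => V ε r 0) (E t (X ε t) 0) t ∧
      HasDerivAt (fun r => V ε r 1) (E t (X ε t) 1 + ε⁻¹ * V ε t 2) t ∧
      HasDerivAt (fun r => V ε r 2) (E t (X ε t) 2 - ε⁻¹ * V ε t 1) t := by
    intro ε hε t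
    have h := hasDerivAt_pi.mp (hVode ε hε t)
    refine ⟨(h 0).congr_deriv ?_, (h 1).congr_deriv ?_, (h 2).congr_deriv ?_⟩ <;>
      simp [cross3, ee1] <;> ring
  have hY := fun t => hasDerivAt_pi.mp (hY0ode t)
  have hU := fun t => hasDerivAt_pi.mp (hU0ode t)
  have hconst : ∀ f : ℝ → ℝ, (∀ t, HasDerivAt f 0 t) → ∀ t, f t = f s := fun f hf t =>
    is_const_of_deriv_eq_zero (fun r => (hf r).differentiableAt) (fun r => (hf r).deriv) t s
  have hY1 : ∀ t, Y0 t 1 = x 1 := fun t => by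
    rw [← hY0init]; exact hconst (fun r => Y0 r 1) (fun r => hY r 1) t
  have hY2 : ∀ t, Y0 t 2 = x 2 := fun t => by
    rw [← hY0init]; exact hconst (fun r => Y0 r 2) (fun r => hY r 2) t
  have hU1 : ∀ t, U0 t 1 = v 1 := fun t => by
    rw [← hU0init]; exact hconst (fun r => U0 r 1) (fun r => hU r 1) t
  have hU2 : ∀ t, U0 t 2 = v 2 := fun t => by
    rw [← hU0init]; exact hconst (fun r => U0 r 2) (fun r => hU r 2) t
  -- The velocities are bounded uniformly in `ε`.
  obtain ⟨B, hB0, hB⟩ : ∃ B, 0 ≤ B ∧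
      ∀ ε, 0 < ε → ∀ t ∈ Icc s (s + T), ∀ i, |V ε t i| ≤ B := by
    refine ⟨√((v 0 ^ 2 + v 1 ^ 2 + v 2 ^ 2 + 2 * M ^ 2 * T) * Real.exp T), Real.sqrt_nonneg _,
      fun ε hε t ht i => ?_⟩
    have hperp := sq_add_sq_le_of_forced_rotation (a := fun r => V ε r 1)
      (b := fun r => V ε r 2) (s := s) (T := T) (δ := v 0 ^ 2 + v 1 ^ 2 + v 2 ^ 2)
      (by positivity) (fun r => (hV ε hε r).2.1) (fun r => (hV ε hε r).2.2)
      (fun r _ => hM _ _ _) (fun r _ => hM _ _ _)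
      (by simp only [hVinit ε hε]; nlinarith [sq_nonneg (v 0)]) t ht
    have hpar := sq_add_sq_le_of_forced_rotation (a := fun r => V ε r 0)
      (b := fun _ => 0) (p := fun r => E r (X ε r) 0) (q := fun _ => 0) (s := s) (T := T)
      (ω := 0) (m := M) (δ := v 0 ^ 2 + v 1 ^ 2 + v 2 ^ 2)
      (by positivity) (fun r => ((hV ε hε r).1).congr_deriv (by simp))
      (fun r => (hasDerivAt_const r 0).congr_deriv (by simp))
      (fun r _ => hM _ _ _) (fun r _ => by simpa using hM0)
      (by simp only [hVinit ε hε]; nlinarith [sq_nonneg (v 1), sq_nonneg (v 2)]) t ht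
    refine Real.abs_le_sqrt ?_
    fin_cases i
    · change V ε t 0 ^ 2 ≤ _
      linarith
    · change V ε t 1 ^ 2 ≤ _
      linarith [sq_nonneg (V ε t 2)]
    · change V ε t 2 ^ 2 ≤ _
      linarith [sq_nonneg (V ε t 1)]
  -- The guiding centre moves by `O(ε)` in the orthogonal directions.
  obtain ⟨A, hA0, hA⟩ : ∃ A, 0 ≤ A ∧ ∀ ε, 0 < ε → ∀ t ∈ Icc s (s + T),
      |X ε t 1 - x 1| ≤ A * ε ∧ |X ε t 2 - x 2| ≤ A * ε := by
    refine ⟨√((v 1 ^ 2 + v 2 ^ 2 + 2 * M ^ 2 * T) * Real.exp T) + B, by positivity,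
      fun ε hε t ht => ?_⟩
    have hgc := sq_add_sq_le_of_forced_rotation (a := fun r => X ε r 1 - x 1 + ε * V ε r 2)
      (b := fun r => X ε r 2 - x 2 - ε * V ε r 1) (p := fun r => ε * E r (X ε r) 2)
      (q := fun r => -(ε * E r (X ε r) 1)) (s := s) (T := T)
      (ω := 0) (m := ε * M) (δ := ε ^ 2 * (v 1 ^ 2 + v 2 ^ 2))
      (by positivity)
      (fun r => (((hX ε hε r 1).sub_const _).add
        ((hV ε hε r).2.2.const_mul ε)).congr_deriv (by field_simp; ring))
      (fun r => (((hX ε hε r 2).sub_const _).sub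
        ((hV ε hε r).2.1.const_mul ε)).congr_deriv (by field_simp; ring))
      (fun r _ => by rw [abs_mul, abs_of_pos hε]; gcongr; exact hM _ _ _)
      (fun r _ => by rw [abs_neg, abs_mul, abs_of_pos hε]; gcongr; exact hM _ _ _)
      (by simp only [hVinit ε hε, hXinit ε hε]; apply le_of_eq; ring) t ht
    obtain ⟨h1, h2⟩ := abs_le_sqrt_mul (K := (v 1 ^ 2 + v 2 ^ 2 + 2 * M ^ 2 * T) * Real.exp T)
      hε (hgc.trans_eq (by ring))
    have hb : ∀ i, |ε * V ε t i| ≤ ε * B := fun i => by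
      rw [abs_mul, abs_of_pos hε]; gcongr; exact hB ε hε t ht i
    have hb1 := abs_le.mp (hb 1)
    have hb2 := abs_le.mp (hb 2)
    rw [abs_le] at h1 h2
    constructor <;> rw [abs_le] <;> constructor <;> linarith [h1.1, h1.2, h2.1, h2.2]
  -- The parallel components are compared by Grönwall's inequality.
  obtain ⟨P, hP⟩ : ∃ P, ∀ ε, 0 < ε → ∀ t ∈ Icc s (s + T),
      |X ε t 0 - Y0 t 0| ≤ P * ε ∧ |V ε t 0 - U0 t 0| ≤ P * ε := by
    refine ⟨√(((L * A) ^ 2 * T) * Real.exp ((2 + L) * T)), fun ε hε t ht => ?_⟩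
    have h := le_of_deriv_le_mul_add
      (f := fun r => (X ε r 0 - Y0 r 0) ^ 2 + (V ε r 0 - U0 r 0) ^ 2)
      (s := s) (T := T) (K := 2 + L) (c := (L * A * ε) ^ 2) (δ := 0)
      (by positivity) (by positivity) le_rfl
      (fun r => (((hX ε hε r 0).sub (hY r 0)).pow 2).add
        (((hV ε hε r).1.sub (hU r 0)).pow 2)) ?_
      (by simp [hXinit ε hε, hVinit ε hε, hY0init, hU0init]) t ht
    · exact abs_le_sqrt_mul hε (h.trans_eq (by ring))
    · intro r hr
      have hn : ‖X ε r - Y0 r‖ ≤ |X ε r 0 - Y0 r 0| + A * ε := by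
        refine (pi_norm_le_iff_of_nonneg (by positivity)).mpr fun i => ?_
        have := abs_nonneg (X ε r 0 - Y0 r 0)
        have hAε : 0 ≤ A * ε := by positivity
        fin_cases i
        · change |X ε r 0 - Y0 r 0| ≤ _
          linarith
        · change |X ε r 1 - Y0 r 1| ≤ _
          rw [hY1]; linarith [(hA ε hε r hr).1]
        · change |X ε r 2 - Y0 r 2| ≤ _
          rw [hY2]; linarith [(hA ε hε r hr).2]
      have hd := (hLip r (X ε r) (Y0 r)).trans (mul_le_mul_of_nonneg_left hn hL0)
      simp only [vpar, Nat.cast_ofNat, Nat.reduceSub, pow_one, Matrix.cons_val_zero, Pi.sub_apply]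
      set a := X ε r 0 - Y0 r 0
      set b := V ε r 0 - U0 r 0
      set d := E r (X ε r) 0 - E r (Y0 r) 0
      have hbd : b * d ≤ |b| * (L * (|a| + A * ε)) :=
        (le_abs_self _).trans (by rw [abs_mul]; gcongr)
      nlinarith [sq_nonneg (a - b), sq_nonneg (|b| - L * A * ε), sq_abs a, sq_abs b,
        mul_nonneg hL0 (sq_nonneg (|a| - |b|))]
  -- The orthogonal velocity is corrected by an `O(ε)` drift term.
  obtain ⟨Q, hQ⟩ : ∃ Q, ∀ ε, 0 < ε → ∀ t ∈ Icc s (s + T),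
      |V ε t 1 - (Real.cos ((t - s) / ε) * v 1 + Real.sin ((t - s) / ε) * v 2)| ≤ Q * ε ∧
      |V ε t 2 - (-Real.sin ((t - s) / ε) * v 1 + Real.cos ((t - s) / ε) * v 2)| ≤ Q * ε := by
    refine ⟨√((2 * M ^ 2 + 2 * (L * (1 + B)) ^ 2 * T) * Real.exp T) + M, fun ε hε t ht => ?_⟩
    set G : ℝ → Fin 3 → ℝ := fun r => fderiv ℝ F (r, X ε r) (1, V ε r) with hG
    have hE : ∀ r i, HasDerivAt (fun r => E r (X ε r) i) (G r i) r := fun r i =>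
      hasDerivAt_pi.mp ((hFd (r, X ε r)).hasFDerivAt.comp_hasDerivAt r
        ((hasDerivAt_id r).prodMk (hXode ε hε r))) i
    have hGb : ∀ r ∈ Icc s (s + T), ∀ i, |ε * G r i| ≤ ε * (L * (1 + B)) := by
      intro r hr i
      rw [abs_mul, abs_of_pos hε]
      have h1 : ‖((1, V ε r) : ℝ × (Fin 3 → ℝ))‖ ≤ 1 + B := by
        refine max_le (by simp [hB0]) ?_
        have : ‖V ε r‖ ≤ B := (pi_norm_le_iff_of_nonneg hB0).mpr fun j => hB ε hε r hr j
        exact this.trans (by linarith)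
      have h2 : ‖G r‖ ≤ L * (1 + B) :=
        (ContinuousLinearMap.le_opNorm _ _).trans (mul_le_mul (hL _) h1 (norm_nonneg _) hL0)
      gcongr
      exact (norm_le_pi_norm (G r) i).trans h2
    have hθ : ∀ r, HasDerivAt (fun r : ℝ => (r - s) / ε) (1 / ε) r := fun r =>
      ((hasDerivAt_id r).sub_const s).div_const ε
    have hrot := sq_add_sq_le_of_forced_rotation
      (a := fun r => V ε r 1 -
        (Real.cos ((r - s) / ε) * v 1 + Real.sin ((r - s) / ε) * v 2) - ε * E r (X ε r) 2)
      (b := fun r => V ε r 2 -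
        (-Real.sin ((r - s) / ε) * v 1 + Real.cos ((r - s) / ε) * v 2) + ε * E r (X ε r) 1)
      (p := fun r => -(ε * G r 2)) (q := fun r => ε * G r 1) (s := s) (T := T)
      (ω := ε⁻¹) (m := ε * (L * (1 + B))) (δ := ε ^ 2 * (2 * M ^ 2))
      (by positivity)
      (fun r => (((hV ε hε r).2.1.sub (((hθ r).cos.mul_const (v 1)).add
        ((hθ r).sin.mul_const (v 2)))).sub ((hE r 2).const_mul ε)).congr_deriv
          (by field_simp; ring))
      (fun r => (((hV ε hε r).2.2.sub (((hθ r).sin.neg.mul_const (v 1)).add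
        ((hθ r).cos.mul_const (v 2)))).add ((hE r 1).const_mul ε)).congr_deriv
          (by field_simp; ring))
      (fun r hr => by rw [abs_neg]; exact hGb r hr 2)
      (fun r hr => hGb r hr 1)
      (by
        have h1 := sq_le_sq.mpr ((hM s x 1).trans (le_abs_self M))
        have h2 := sq_le_sq.mpr ((hM s x 2).trans (le_abs_self M))
        simp only [hVinit ε hε, hXinit ε hε, sub_self, zero_div, Real.cos_zero, Real.sin_zero]
        nlinarith [mul_le_mul_of_nonneg_left (add_le_add h1 h2) (sq_nonneg ε)]) t ht
    obtain ⟨h1, h2⟩ := abs_le_sqrt_mul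
      (K := (2 * M ^ 2 + 2 * (L * (1 + B)) ^ 2 * T) * Real.exp T) hε (hrot.trans_eq (by ring))
    have hb : ∀ i, |ε * E t (X ε t) i| ≤ ε * M := fun i => by
      rw [abs_mul, abs_of_pos hε]; gcongr; exact hM _ _ _
    have hb1 := abs_le.mp (hb 1)
    have hb2 := abs_le.mp (hb 2)
    rw [abs_le] at h1 h2
    constructor <;> rw [abs_le] <;> constructor <;> linarith [h1.1, h1.2, h2.1, h2.2]
  have : Nonempty (Icc s (s + T)) := ⟨⟨s, by simp [hT.le]⟩⟩
  constructor
  · refine tendsto_iSup_zero_of_le_mul (C := P + A + A) (fun _ _ => Real.sqrt_nonneg _)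
      fun ε hε _ ⟨t, ht⟩ => (euclN_le_abs_add _).trans ?_
    simp only [Pi.sub_apply, hY1, hY2]
    linarith [(hP ε hε t ht).1, (hA ε hε t ht).1, (hA ε hε t ht).2]
  · refine tendsto_iSup_zero_of_le_mul (C := P + Q + Q) (fun _ _ => Real.sqrt_nonneg _)
      fun ε hε _ ⟨t, ht⟩ => (euclN_le_abs_add _).trans ?_
    have e0 : ((Rrot ((t - s) / ε)).mulVec (U0 t)) 0 = U0 t 0 := by
      simp [Rrot, Matrix.mulVec, dotProduct, Fin.sum_univ_three]
    have e1 : ((Rrot ((t - s) / ε)).mulVec (U0 t)) 1 =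
        Real.cos ((t - s) / ε) * v 1 + Real.sin ((t - s) / ε) * v 2 := by
      simp [Rrot, Matrix.mulVec, dotProduct, Fin.sum_univ_three, hU1, hU2]
    have e2 : ((Rrot ((t - s) / ε)).mulVec (U0 t)) 2 =
        -Real.sin ((t - s) / ε) * v 1 + Real.cos ((t - s) / ε) * v 2 := by
      simp [Rrot, Matrix.mulVec, dotProduct, Fin.sum_univ_three, hU1, hU2]
    simp only [Pi.sub_apply, e0, e1, e2]
    linarith [(hP ε hε t ht).2, (hQ ε hε t ht).1, (hQ ε hε t ht).2]
end

section
/- For every 3×3 real matrix A and every θ ∈ ℝ: ∫₀^θ R(−σ) A 𝓡(σ) dσ − (θ/2π)∫₀^{2π} R(−σ) A 𝓡(σ) dσ = P A (I − R(θ)) + (1/2)(−𝓡(−θ) + R(π/2) − P) A (𝓡(θ) + R(π/2) − P) + (1/2)(R(−π/2) − P) A (R(π/2) − P). -/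
open Real

/-- Entrywise interval integral of a matrix-valued function. -/
noncomputable def intMatrix (f : ℝ → Matrix (Fin 3) (Fin 3) ℝ) (a b : ℝ) :
    Matrix (Fin 3) (Fin 3) ℝ :=
  Matrix.of fun i j => ∫ σ in a..b, f σ i j

/-- The orthogonal projection onto the plane of the last two axes. -/
noncomputable def planeProj : Matrix (Fin 3) (Fin 3) ℝ := !![0, 0, 0; 0, 1, 0; 0, 0, 1]

/-- The generator of the rotations `Rrot`. -/
noncomputable def rotGen : Matrix (Fin 3) (Fin 3) ℝ := !![0, 0, 0; 0, 0, 1; 0, -1, 0]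

theorem Rrot_eq (θ : ℝ) :
    Rrot θ = Pmat + Real.cos θ • planeProj + Real.sin θ • rotGen := by
  ext i j
  fin_cases i <;> fin_cases j <;> simp [Rrot, Pmat, planeProj, rotGen]

theorem scrR_eq (θ : ℝ) :
    scrR θ = Real.sin θ • planeProj + (1 - Real.cos θ) • rotGen := by
  ext i j
  fin_cases i <;> fin_cases j <;> simp [scrR, planeProj, rotGen]

theorem Pmat_add_planeProj : Pmat + planeProj = 1 := by
  ext i j
  fin_cases i <;> fin_cases j <;> simp [Pmat, planeProj]

theorem hasDerivAt_trig_combination (p q a b d e x : ℝ) :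
    HasDerivAt (fun t => (1 - Real.cos t) * p + (t - Real.sin t) * q
        + Real.sin t ^ 2 / 2 * a + (Real.sin t - (t + Real.sin t * Real.cos t) / 2) * b
        - (t - Real.sin t * Real.cos t) / 2 * d
        - (1 - Real.cos t - Real.sin t ^ 2 / 2) * e)
      (Real.sin x * p + (1 - Real.cos x) * q + Real.cos x * Real.sin x * a
        + Real.cos x * (1 - Real.cos x) * b - Real.sin x ^ 2 * d
        - Real.sin x * (1 - Real.cos x) * e) x := by
  have hs := Real.hasDerivAt_sin x
  have hc := Real.hasDerivAt_cos x
  have hi := hasDerivAt_id x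
  have hone := hc.const_sub 1
  have hsq := (hs.pow 2).div_const 2
  have hsc := hs.mul hc
  have key := ((((((hone.mul_const p).add ((hi.sub hs).mul_const q)).add
    (hsq.mul_const a)).add ((hs.sub ((hi.add hsc).div_const 2)).mul_const b)).sub
    (((hi.sub hsc).div_const 2).mul_const d)).sub ((hone.sub hsq).mul_const e))
  refine key.congr_deriv ?_
  have h := Real.sin_sq_add_cos_sq x
  norm_num
  linear_combination ((b + d) / 2) * h

theorem intMatrix_Rrot_scrR (A : Matrix (Fin 3) (Fin 3) ℝ) (θ : ℝ) :
    intMatrix (fun σ => Rrot (-σ) * A * scrR σ) 0 θ =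
      (1 - Real.cos θ) • (Pmat * A * planeProj) + (θ - Real.sin θ) • (Pmat * A * rotGen)
        + (Real.sin θ ^ 2 / 2) • (planeProj * A * planeProj)
        + (Real.sin θ - (θ + Real.sin θ * Real.cos θ) / 2) • (planeProj * A * rotGen)
        - ((θ - Real.sin θ * Real.cos θ) / 2) • (rotGen * A * planeProj)
        - (1 - Real.cos θ - Real.sin θ ^ 2 / 2) • (rotGen * A * rotGen) := by
  have hf : ∀ σ : ℝ, Rrot (-σ) * A * scrR σ =
      Real.sin σ • (Pmat * A * planeProj) + (1 - Real.cos σ) • (Pmat * A * rotGen)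
        + (Real.cos σ * Real.sin σ) • (planeProj * A * planeProj)
        + (Real.cos σ * (1 - Real.cos σ)) • (planeProj * A * rotGen)
        - (Real.sin σ ^ 2) • (rotGen * A * planeProj)
        - (Real.sin σ * (1 - Real.cos σ)) • (rotGen * A * rotGen) := by
    intro σ
    simp only [Rrot_eq, scrR_eq, Real.cos_neg, Real.sin_neg, add_mul, mul_add, smul_mul_assoc,
      mul_smul_comm]
    module
  ext i j
  simp only [intMatrix, hf, Matrix.of_apply, Matrix.add_apply, Matrix.sub_apply,
    Matrix.smul_apply, smul_eq_mul]
  rw [intervalIntegral.integral_eq_sub_of_hasDerivAt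
    (fun x _ => hasDerivAt_trig_combination _ _ _ _ _ _ x)
    (Continuous.intervalIntegrable (by fun_prop) _ _)]
  simp

/-- `∫₀^θ R(−σ)A𝓡(σ)dσ − (θ/2π)∫₀^{2π} R(−σ)A𝓡(σ)dσ
  = PA(I−R(θ)) + (1/2)(−𝓡(−θ)+R(π/2)−P)A(𝓡(θ)+R(π/2)−P) + (1/2)(R(−π/2)−P)A(R(π/2)−P)`. -/
theorem stmt_19 (A : Matrix (Fin 3) (Fin 3) ℝ) (θ : ℝ) :
    intMatrix (fun σ => Rrot (-σ) * A * scrR σ) 0 θ -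
        (θ / (2 * π)) • intMatrix (fun σ => Rrot (-σ) * A * scrR σ) 0 (2 * π) =
      Pmat * A * ((1 : Matrix (Fin 3) (Fin 3) ℝ) - Rrot θ) +
      (1 / 2 : ℝ) • ((-scrR (-θ) + Rrot (π / 2) - Pmat) * A *
        (scrR θ + Rrot (π / 2) - Pmat)) +
      (1 / 2 : ℝ) • ((Rrot (-(π / 2)) - Pmat) * A * (Rrot (π / 2) - Pmat)) := by
  have hJ : Rrot (π / 2) = Pmat + rotGen := by simp [Rrot_eq]
  have hJ' : Rrot (-(π / 2)) = Pmat - rotGen := by simp [Rrot_eq, sub_eq_add_neg]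
  have hπ : θ / (2 * π) * (2 * π) = θ := div_mul_cancel₀ _ (by positivity)
  have hsc : Real.sin θ ^ 2 = 1 - Real.cos θ ^ 2 := Real.sin_sq θ
  rw [intMatrix_Rrot_scrR, intMatrix_Rrot_scrR, hJ, hJ', ← Pmat_add_planeProj, Rrot_eq,
    scrR_eq, scrR_eq]
  simp only [Real.cos_neg, Real.sin_neg, Real.cos_two_pi, Real.sin_two_pi]
  ext i j
  simp only [add_mul, mul_add, sub_mul, mul_sub, neg_mul, smul_mul_assoc, mul_smul_comm,
    Matrix.add_apply, Matrix.sub_apply, Matrix.neg_apply, Matrix.smul_apply, smul_eq_mul]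
  linear_combination
    ((planeProj * A * rotGen) i j / 2 + (rotGen * A * planeProj) i j / 2
      - (Pmat * A * rotGen) i j) * hπ + (rotGen * A * rotGen) i j / 2 * hsc
end
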